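/- Let T(G) = (I−G)^{-1} with G supported on a directed graph's edges, and let 𝓙, 𝓘 be vertex subsets. The generic rank of the submatrix T_{𝓘,𝓙} (rows 𝓘, columns 𝓙) equals the maximum number of vertex-disjoint directed paths from 𝓙 to 𝓘 in the graph. -/

import Mathlib

open Matrix

/-- The columns of a matrix contain a linearly independent family as large as the rank. -/
theorem Matrix.exists_linearIndependent_col_submatrix {m n K : Type*} [Finite m] [Fintype n]
    [Field K] (A : Matrix m n K) {r : ℕ} (hr : A.rank = r) :
    ∃ g : Fin r → n, LinearIndependent K (A.submatrix id g).col := by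
  rw [A.rank_eq_finrank_span_cols] at hr
  subst hr
  obtain ⟨v, hv, -, hli⟩ := Submodule.exists_fun_fin_finrank_span_eq K (Set.range A.col)
  choose g hg using hv
  refine ⟨g, ?_⟩
  convert! hli using 1
  exact funext hg

/-- A matrix over a field has a nonzero minor whose order is its rank. -/
theorem Matrix.exists_submatrix_det_ne_zero {m n K : Type*} [Fintype m] [Fintype n] [Field K]
    (A : Matrix m n K) :
    ∃ (f : Fin A.rank → m) (g : Fin A.rank → n), (A.submatrix f g).det ≠ 0 := by
  obtain ⟨g, hg⟩ := A.exists_linearIndependent_col_submatrix rfl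
  have hrank : (A.submatrix id g)ᵀ.rank = A.rank := by
    simpa using LinearIndependent.rank_matrix (M := (A.submatrix id g)ᵀ) hg
  obtain ⟨f, hf⟩ := (A.submatrix id g)ᵀ.exists_linearIndependent_col_submatrix hrank
  refine ⟨f, g, ?_⟩
  have hunit := Matrix.linearIndependent_cols_iff_isUnit.1 hf
  rw [Matrix.isUnit_iff_isUnit_det] at hunit
  rw [← det_transpose]
  exact hunit.ne_zero

/-- A permutation of `V ⊕ Fin k` that maps no point of `Fin k` into `Fin k` decomposes the cycles
through `Fin k` into `k` disjoint paths in `V`, one for each excursion from `Fin k` to itself. -/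
theorem Equiv.Perm.exists_disjoint_paths {V : Type*} [Finite V] {k : ℕ}
    (σ : Equiv.Perm (V ⊕ Fin k)) (hσ : ∀ a b, σ (Sum.inr a) ≠ Sum.inr b) :
    ∃ paths : Fin k → List V,
      (∀ a, paths a ≠ [] ∧
        (paths a).IsChain (fun u v => u ≠ v ∧ σ (Sum.inl u) = Sum.inl v) ∧
        (∃ j, σ (Sum.inr a) = Sum.inl j ∧ (paths a).head? = some j) ∧
        (∃ i b, σ (Sum.inl i) = Sum.inr b ∧ (paths a).getLast? = some i)) ∧
      ∀ a b, a ≠ b → ∀ v, v ∈ paths a → v ∉ paths b := by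
  classical
  have hret : ∀ a, ∃ m : ℕ, ∃ b, (σ ^ (m + 1)) (Sum.inr a) = Sum.inr b := fun a => by
    obtain ⟨N, hN, hN'⟩ := isOfFinOrder_iff_pow_eq_one.1 (isOfFinOrder_of_finite σ)
    refine ⟨N - 1, a, ?_⟩
    rw [Nat.sub_add_cancel hN, hN']
    rfl
  let m : Fin k → ℕ := fun a => Nat.find (hret a)
  have hm : ∀ a, ∃ b, (σ ^ (m a + 1)) (Sum.inr a) = Sum.inr b := fun a => Nat.find_spec (hret a)
  have hmin : ∀ a t, t < m a → ∃ v, (σ ^ (t + 1)) (Sum.inr a) = Sum.inl v := fun a t ht => by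
    have := Nat.find_min (hret a) ht
    rcases h : (σ ^ (t + 1)) (Sum.inr a) with v | b
    · exact ⟨v, rfl⟩
    · exact absurd ⟨b, h⟩ this
  have hm0 : ∀ a, 0 < m a := fun a => by
    rw [Nat.pos_iff_ne_zero]
    intro h
    obtain ⟨b, hb⟩ := hm a
    rw [h, zero_add, pow_one] at hb
    exact hσ a b hb
  have hsucc : ∀ a t, σ ((σ ^ t) (Sum.inr a)) = (σ ^ (t + 1)) (Sum.inr a) := fun a t => by
    rw [pow_succ', Equiv.Perm.mul_apply]
  choose p hp using hmin
  have key : ∀ a b s t (hs : s < m a) (ht : t < m b), s ≤ t → p a s hs = p b t ht → a = b := by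
    intro a b s t hs ht hst h
    have h1 : (σ ^ (s + 1)) (Sum.inr a) = (σ ^ (s + 1)) ((σ ^ (t - s)) (Sum.inr b)) := by
      rw [hp a s hs, h, ← hp b t ht, ← Equiv.Perm.mul_apply, ← pow_add]
      congr 2
      omega
    have h2 := (σ ^ (s + 1)).injective h1
    rcases hd : t - s with _ | d
    · rw [hd, pow_zero] at h2
      exact Sum.inr.inj h2
    · rw [hd, hp b d (by omega)] at h2
      cases h2
  refine ⟨fun a => List.ofFn fun t : Fin (m a) => p a t t.2, fun a => ⟨?_, ?_, ?_, ?_⟩, ?_⟩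
  · simpa [List.ofFn_eq_nil_iff] using (hm0 a).ne'
  · rw [List.isChain_ofFn]
    intro t ht
    have h1 : σ (Sum.inl (p a t (by omega))) = Sum.inl (p a (t + 1) ht) := by
      rw [← hp a t (by omega), hsucc, hp a (t + 1) ht]
    refine ⟨fun h => ?_, h1⟩
    have h2 : ∀ d, (σ ^ d) (Sum.inl (p a t (by omega))) = Sum.inl (p a t (by omega)) := fun d =>
      Equiv.Perm.pow_apply_eq_self_of_apply_eq_self (h1.trans (by rw [← h])) d
    obtain ⟨b, hb⟩ := hm a
    have h3 := h2 (m a - t)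
    rw [← hp a t (by omega), ← Equiv.Perm.mul_apply, ← pow_add,
      show m a - t + (t + 1) = m a + 1 by omega, hb, hp a t (by omega)] at h3
    cases h3
  · refine ⟨p a 0 (hm0 a), by simpa using hp a 0 (hm0 a), ?_⟩
    rw [List.head?_eq_getElem?]
    simp [hm0 a]
  · obtain ⟨b, hb⟩ := hm a
    have h0 := hm0 a
    refine ⟨p a (m a - 1) (by omega), b, ?_, ?_⟩
    · rw [← hp a (m a - 1) (by omega), hsucc, Nat.sub_add_cancel h0, hb]
    · rw [List.getLast?_eq_getElem?]
      simp [hm0 a]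
  · intro a b hab v ha hb
    rw [List.mem_ofFn'] at ha hb
    obtain ⟨s, rfl⟩ := ha
    obtain ⟨t, ht⟩ := hb
    rcases le_total s.1 t.1 with h | h
    · exact hab (key a b s t s.2 t.2 h ht.symm)
    · exact hab (key b a t s t.2 s.2 h ht).symm

/-- A nonzero minor of `(1 - G)⁻¹` with rows `f` and columns `g` yields a nonzero term in the
expansion of the determinant of `1 - G` bordered by the corresponding unit vectors. -/
theorem Matrix.exists_perm_of_det_submatrix_inv_one_sub_ne_zero {V K : Type*} [Fintype V]
    [DecidableEq V] [Field K] {G : Matrix V V K} (hG : IsUnit (1 - G)) {k : ℕ} {f g : Fin k → V}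
    (h : ((1 - G)⁻¹.submatrix f g).det ≠ 0) :
    ∃ σ : Equiv.Perm (V ⊕ Fin k), (∀ a b, σ (Sum.inr a) ≠ Sum.inr b) ∧
      (∀ u v, σ (Sum.inl u) = Sum.inl v → u ≠ v → G v u ≠ 0) ∧
      (∀ a v, σ (Sum.inr a) = Sum.inl v → v = g a) ∧
      (∀ v a, σ (Sum.inl v) = Sum.inr a → v = f a) := by
  have := hG.invertible
  let P : Matrix V (Fin k) K := (1 : Matrix V V K).submatrix id g
  let Q : Matrix (Fin k) V K := (1 : Matrix V V K).submatrix f id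
  have hB : (fromBlocks (1 - G) P Q 0).det ≠ 0 := by
    rw [det_fromBlocks₁₁]
    refine mul_ne_zero ((Matrix.isUnit_iff_isUnit_det _).1 hG).ne_zero ?_
    have hT : Q * ⅟(1 - G) * P = (1 - G)⁻¹.submatrix f g := by
      rw [invOf_eq_nonsing_inv]
      ext a b
      simp [P, Q, Matrix.mul_apply, Matrix.one_apply]
    rw [zero_sub, hT, det_neg]
    exact mul_ne_zero (pow_ne_zero _ (by simp)) h
  rw [det_apply] at hB
  obtain ⟨σ, -, hσ⟩ := Finset.exists_ne_zero_of_sum_ne_zero hB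
  have hentry : ∀ x, fromBlocks (1 - G) P Q 0 (σ x) x ≠ 0 := fun x hx => hσ (by
    rw [Finset.prod_eq_zero (f := fun i => fromBlocks (1 - G) P Q 0 (σ i) i)
      (Finset.mem_univ x) hx, smul_zero])
  refine ⟨σ, fun a b hab => ?_, fun u v huv hne hz => ?_, fun a v hav => ?_, fun v a hva => ?_⟩
  · have := hentry (Sum.inr a)
    simp [hab] at this
  · have := hentry (Sum.inl u)
    simp [huv, hz, hne.symm] at this
  · have := hentry (Sum.inr a)
    simpa [hav, P, Matrix.one_apply] using this
  · have := hentry (Sum.inl v)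
    simpa [hva, Q, Matrix.one_apply, eq_comm] using this

/-- A walk along positive entries of a nonnegative matrix makes an entry of some power positive. -/
theorem Matrix.exists_pow_apply_pos_of_isChain {V : Type*} [Fintype V] [DecidableEq V]
    {G : Matrix V V ℝ} (hG : ∀ u v, 0 ≤ G u v) {i : V} :
    ∀ {l : List V} {j : V}, l.IsChain (fun u v => 0 < G v u) → l.head? = some j →
      l.getLast? = some i → ∃ m : ℕ, 0 < (G ^ m) i j
  | [], _, _, h, _ => by simp at h
  | [x], j, _, h1, h2 => by
    simp only [List.head?_cons, Option.some.injEq, List.getLast?_singleton] at h1 h2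
    subst h1 h2
    exact ⟨0, by simp⟩
  | x :: y :: l, j, hc, h1, h2 => by
    simp only [List.head?_cons, Option.some.injEq] at h1
    subst h1
    rw [List.isChain_cons_cons] at hc
    obtain ⟨m, hm⟩ := exists_pow_apply_pos_of_isChain hG (j := y) hc.2 rfl (by simpa using h2)
    refine ⟨m + 1, ?_⟩
    rw [pow_succ, Matrix.mul_apply]
    exact Finset.sum_pos' (fun w _ => mul_nonneg (pow_apply_nonneg hG m _ _) (hG _ _))
      ⟨y, Finset.mem_univ y, mul_pos hm hc.1⟩

/-- The entrywise Neumann series of a real matrix with absolute row sums less than one. -/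
theorem Matrix.exists_mul_eq_one_hasSum_pow_apply {V : Type*} [Fintype V] [DecidableEq V]
    {G : Matrix V V ℝ} (hG : ∀ u, ∑ v, ‖G u v‖ < 1) :
    ∃ T : Matrix V V ℝ, (1 - G) * T = 1 ∧ ∀ u v, HasSum (fun m : ℕ => (G ^ m) u v) (T u v) := by
  let _ := Matrix.linftyOpNormedRing (n := V) (α := ℝ)
  let _ := Matrix.linftyOpNormedAlgebra (n := V) (R := ℝ) (α := ℝ)
  have := FiniteDimensional.complete ℝ (Matrix V V ℝ)
  have h1 : ‖G‖ < 1 := by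
    rw [linfty_opNorm_def, ← NNReal.coe_one, NNReal.coe_lt_coe, Finset.sup_lt_iff (by simp)]
    intro u _
    rw [← NNReal.coe_lt_coe]
    simpa using hG u
  refine ⟨∑' m : ℕ, G ^ m, mul_neg_geom_series G h1, fun u v => ?_⟩
  exact (summable_geometric_of_norm_lt_one h1).hasSum.map
    (Matrix.entryAddMonoidHom ℝ u v) (continuous_id.matrix_elem u v)

/-- Disjoint paths are realised by a matrix supported on their edges whose resolvent is diagonal
and invertible between the end points and the starting points. -/
theorem exists_resolvent_of_disjoint_paths {V : Type*} [Fintype V] [DecidableEq V]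
    (E : Set (V × V)) {k : ℕ} (paths : Fin k → List V) (i j : Fin k → V)
    (hchain : ∀ a, (paths a).IsChain (fun u v => (v, u) ∈ E))
    (hj : ∀ a, (paths a).head? = some (j a)) (hi : ∀ a, (paths a).getLast? = some (i a))
    (hdisj : ∀ a b, a ≠ b → ∀ v, v ∈ paths a → v ∉ paths b) :
    ∃ G T : Matrix V V ℝ, (∀ u v, (u, v) ∉ E → G u v = 0) ∧ (1 - G) * T = 1 ∧
      (T.submatrix i j).det ≠ 0 := by
  classical
  let t : ℝ := 1 / (Fintype.card V + 1)
  have ht : 0 < t := by positivity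
  let G : Matrix V V ℝ := Matrix.of fun u v =>
    if (u, v) ∈ E ∧ ∃ a, u ∈ paths a ∧ v ∈ paths a then t else 0
  have hG0 : ∀ u v, 0 ≤ G u v := fun u v => by
    simp only [G, Matrix.of_apply]
    split_ifs <;> positivity
  have hGt : ∀ u v, G u v ≤ t := fun u v => by
    simp only [G, Matrix.of_apply]
    split_ifs <;> linarith
  obtain ⟨T, hT, hsum⟩ := Matrix.exists_mul_eq_one_hasSum_pow_apply (G := G) fun u => by
    calc ∑ v, ‖G u v‖ ≤ ∑ _v : V, t :=
          Finset.sum_le_sum fun v _ => by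
            rw [Real.norm_of_nonneg (hG0 u v)]
            exact hGt u v
      _ < 1 := by
          rw [Finset.sum_const, Finset.card_univ, nsmul_eq_mul, mul_one_div,
            div_lt_one (by positivity)]
          linarith
  have hdiag : ∀ a, 0 < T (i a) (j a) := fun a => by
    have hc : (paths a).IsChain (fun u v => 0 < G v u) := by
      rw [List.isChain_iff_getElem]
      intro s hs
      have : (((paths a)[s + 1], (paths a)[s]) ∈ E ∧
          ∃ b, (paths a)[s + 1] ∈ paths b ∧ (paths a)[s] ∈ paths b) :=
        ⟨(hchain a).getElem s hs, a, List.getElem_mem _, List.getElem_mem _⟩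
      simp only [G, Matrix.of_apply, if_pos this, ht]
    obtain ⟨m, hm⟩ := Matrix.exists_pow_apply_pos_of_isChain hG0 hc (hj a) (hi a)
    exact hm.trans_le (le_hasSum (hsum _ _) m fun b _ => Matrix.pow_apply_nonneg hG0 b _ _)
  have hoff : ∀ a b, a ≠ b → T (i a) (j b) = 0 := fun a b hab => by
    have hpow : ∀ m : ℕ, ∀ u, u ∉ paths b → (G ^ m) u (j b) = 0 := fun m => by
      induction m with
      | zero =>
        intro u hu
        have : u ≠ j b := fun h => hu (h ▸ List.mem_of_head? (hj b))
        simp [this]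
      | succ m ih =>
        intro u hu
        rw [pow_succ', Matrix.mul_apply]
        refine Finset.sum_eq_zero fun w _ => ?_
        by_cases hw : w ∈ paths b
        · have : ¬ ((u, w) ∈ E ∧ ∃ c, u ∈ paths c ∧ w ∈ paths c) := by
            rintro ⟨-, c, huc, hwc⟩
            have hcb : c ≠ b := fun h => hu (h ▸ huc)
            exact hdisj c b hcb w hwc hw
          simp only [G, Matrix.of_apply, if_neg this, zero_mul]
        · rw [ih w hw, mul_zero]
    have h0 := hsum (i a) (j b)
    simp only [hpow _ (i a) (hdisj a b hab _ (List.mem_of_getLast? (hi a)))] at h0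
    exact h0.unique hasSum_zero
  refine ⟨G, T, fun u v huv => ?_, hT, ?_⟩
  · simp [G, huv]
  · have : T.submatrix i j = Matrix.diagonal fun a => T (i a) (j a) := by
      ext a b
      by_cases hab : a = b
      · simp [hab]
      · simp [hab, hoff a b hab]
    rw [this, Matrix.det_diagonal]
    exact Finset.prod_ne_zero_iff.2 fun a _ => (hdiag a).ne'

/-- Van der Woude: the generic rank of the submatrix `T_{𝓘,𝓙}` of `T(G) = (I−G)⁻¹`, over
matrices `G` supported on the edge set `E` (edge `j → i` when `(i,j) ∈ E`), equals the maximum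
number of vertex-disjoint directed paths from `𝓙` to `𝓘` in the graph (length-zero paths
allowed). -/
theorem stmt16 (n : ℕ) (E : Set (Fin n × Fin n)) (I J : Finset (Fin n)) :
    sSup {r : ℕ | ∃ G : Matrix (Fin n) (Fin n) ℂ,
        (∀ a b, (a, b) ∉ E → G a b = 0) ∧
        (((1 - G)⁻¹).submatrix (fun i : {x // x ∈ I} => i.1)
          (fun j : {x // x ∈ J} => j.1)).rank = r} =
      sSup {k : ℕ | ∃ paths : Fin k → List (Fin n),
        (∀ a : Fin k, paths a ≠ [] ∧
          (paths a).Chain' (fun u v => (v, u) ∈ E) ∧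
          (∃ jj ∈ J, (paths a).head? = some jj) ∧
          (∃ ii ∈ I, (paths a).getLast? = some ii)) ∧
        ∀ a b : Fin k, a ≠ b → ∀ v, v ∈ paths a → v ∉ paths b} := by
  refine le_antisymm (csSup_le' ?_) (csSup_le' ?_)
  · rintro r ⟨G, hGE, rfl⟩
    by_cases hG : IsUnit (1 - G)
    · refine le_csSup ⟨n, ?_⟩ ?_
      · rintro k ⟨paths, hp, hdisj⟩
        choose j _ hj using fun a => (hp a).2.2.1
        have hinj : Function.Injective j := fun a b hab => by
          by_contra hne
          exact hdisj a b hne (j a) (List.mem_of_head? (hj a))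
            (hab ▸ List.mem_of_head? (hj b))
        simpa using Fintype.card_le_of_injective j hinj
      · obtain ⟨f, g, hfg⟩ := Matrix.exists_submatrix_det_ne_zero
          (((1 - G)⁻¹).submatrix (fun i : {x // x ∈ I} => i.1) (fun j : {x // x ∈ J} => j.1))
        rw [Matrix.submatrix_submatrix] at hfg
        obtain ⟨σ, hσ, hedge, hstart, hend⟩ :=
          Matrix.exists_perm_of_det_submatrix_inv_one_sub_ne_zero hG hfg
        obtain ⟨paths, hp, hdisj⟩ := σ.exists_disjoint_paths hσ
        refine ⟨paths, fun a => ?_, hdisj⟩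
        obtain ⟨hne, hc, ⟨j, hj, hhead⟩, i, b, hi, hlast⟩ := hp a
        refine ⟨hne, hc.imp fun u v huv => ?_, ⟨j, ?_, hhead⟩, i, ?_, hlast⟩
        · by_contra hE
          exact hedge u v huv.2 huv.1 (hGE v u hE)
        · rw [hstart a j hj]
          exact (g a).2
        · rw [hend i b hi]
          exact (f b).2
    · rw [Matrix.isUnit_iff_isUnit_det] at hG
      rw [Matrix.nonsing_inv_apply_not_isUnit _ hG, Matrix.submatrix_zero, Pi.zero_apply,
        Pi.zero_apply, Matrix.rank_zero]
      exact Nat.zero_le _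
  · rintro k ⟨paths, hp, hdisj⟩
    choose j hjJ hj using fun a => (hp a).2.2.1
    choose i hiI hi using fun a => (hp a).2.2.2
    obtain ⟨G, T, hGE, hT, hdet⟩ :=
      exists_resolvent_of_disjoint_paths E paths i j (fun a => (hp a).2.1) hj hi hdisj
    let c : ℝ →+* ℂ := Complex.ofRealHom
    have hinv : (1 - c.mapMatrix G)⁻¹ = c.mapMatrix T := by
      refine Matrix.inv_eq_right_inv ?_
      rw [← map_one c.mapMatrix, ← map_sub, ← map_mul, hT]
    refine le_trans ?_ (le_csSup ⟨I.card, ?_⟩ ⟨c.mapMatrix G, fun u v huv => ?_, rfl⟩)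
    · have hminor : ((c.mapMatrix T).submatrix i j).det ≠ 0 := by
        have : (c.mapMatrix T).submatrix i j = c.mapMatrix (T.submatrix i j) := rfl
        rw [this, ← RingHom.map_det]
        exact (map_ne_zero c).2 hdet
      have hrank := Matrix.rank_of_det_ne_zero hminor
      rw [Fintype.card_fin] at hrank
      rw [hinv, ← hrank]
      exact Matrix.rank_submatrix_le ((c.mapMatrix T).submatrix (fun i : {x // x ∈ I} => i.1)
        (fun j : {x // x ∈ J} => j.1)) (fun a => ⟨i a, hiI a⟩) (fun a => ⟨j a, hjJ a⟩)
    · rintro r ⟨G', -, rfl⟩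
      simpa using Matrix.rank_le_card_height (((1 - G')⁻¹).submatrix
        (fun i : {x // x ∈ I} => i.1) (fun j : {x // x ∈ J} => j.1))
    · simp [hGE u v huv]
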